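/- Let M be a Noetherian uniserial R-module. Then there exists a ∈ R such that E_M(0) = aΓ_a(M) = S(M), where S(M) is the semiprime radical of the zero submodule of M. -/

import Mathlib

open Submodule

universe u v

/-- The envelope `E_M(N)` of a submodule `N` of `M`:
the set of elements `a • m` with `a ^ k • m ∈ N` for some positive integer `k`. -/
def envSet {R : Type u} [CommRing R] {M : Type v} [AddCommGroup M] [Module R M]
    (N : Submodule R M) : Set M :=
  {x | ∃ (a : R) (m : M) (k : ℕ), 0 < k ∧ a ^ k • m ∈ N ∧ x = a • m}

/-- The submodule `⟨E_M(N)⟩` generated by the envelope of `N`. -/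
def envSub {R : Type u} [CommRing R] {M : Type v} [AddCommGroup M] [Module R M]
    (N : Submodule R M) : Submodule R M :=
  Submodule.span R (envSet N)

/-- `chainSub N n = ⟨E_n(N)⟩`: the ascending chain with `⟨E_0(N)⟩ = N` and
`⟨E_{n+1}(N)⟩ = ⟨E_M(⟨E_n(N)⟩)⟩`. -/
def chainSub {R : Type u} [CommRing R] {M : Type v} [AddCommGroup M] [Module R M]
    (N : Submodule R M) : ℕ → Submodule R M
  | 0 => N
  | n + 1 => envSub (chainSub N n)

/-- A proper submodule `K` is semiprime if `a ^ 2 • m ∈ K` implies `a • m ∈ K`. -/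
def IsSemiprimeSub {R : Type u} [CommRing R] {M : Type v} [AddCommGroup M] [Module R M]
    (K : Submodule R M) : Prop :=
  K ≠ ⊤ ∧ ∀ (a : R) (m : M), a ^ 2 • m ∈ K → a • m ∈ K

/-- The semiprime radical `S(N)`: the intersection of all semiprime submodules containing `N`. -/
def spRadical {R : Type u} [CommRing R] {M : Type v} [AddCommGroup M] [Module R M]
    (N : Submodule R M) : Submodule R M :=
  sInf {K | IsSemiprimeSub K ∧ N ≤ K}

/-- A proper submodule `P` is prime if `a • m ∈ P` implies `m ∈ P` or `a • M ⊆ P`. -/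
def IsPrimeSub {R : Type u} [CommRing R] {M : Type v} [AddCommGroup M] [Module R M]
    (P : Submodule R M) : Prop :=
  P ≠ ⊤ ∧ ∀ (a : R) (m : M), a • m ∈ P → m ∈ P ∨ ∀ x : M, a • x ∈ P

/-- The prime radical `β(N)`: the intersection of all prime submodules containing `N`. -/
def primeRadical {R : Type u} [CommRing R] {M : Type v} [AddCommGroup M] [Module R M]
    (N : Submodule R M) : Submodule R M :=
  sInf {P | IsPrimeSub P ∧ N ≤ P}

/-- `Γ_a(M) = {m : a ^ k • m = 0 for some positive integer k}`. -/
def Gamma {R : Type u} [CommRing R] {M : Type v} [AddCommGroup M] [Module R M]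
    (a : R) : Submodule R M where
  carrier := {m | ∃ k : ℕ, 0 < k ∧ a ^ k • m = 0}
  zero_mem' := ⟨1, one_pos, smul_zero _⟩
  add_mem' := by
    rintro x y ⟨k, hk, hx⟩ ⟨l, hl, hy⟩
    refine ⟨k + l, by omega, ?_⟩
    have h1 : a ^ (k + l) • x = 0 := by rw [pow_add, mul_comm, mul_smul, hx, smul_zero]
    have h2 : a ^ (k + l) • y = 0 := by rw [pow_add, mul_smul, hy, smul_zero]
    rw [smul_add, h1, h2, add_zero]
  smul_mem' := by
    rintro c x ⟨k, hk, hx⟩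
    exact ⟨k, hk, by rw [smul_comm, hx, smul_zero]⟩

/-- `aΓ_a(M)`: the image of `Γ_a(M)` under multiplication by `a`. -/
def aGamma {R : Type u} [CommRing R] {M : Type v} [AddCommGroup M] [Module R M]
    (a : R) : Submodule R M :=
  (Gamma (M := M) a).map (LinearMap.lsmul R M a)

/-- An element `m` of an `R`-module is nilpotent if `m = Σ_{i=1}^r a_i • m_i` with
`a_i ^ k • m_i = 0` for all `i`, for some positive integers `r`, `k`. -/
def IsNilpotentElem (R : Type u) [CommRing R] {M : Type v} [AddCommGroup M] [Module R M]
    (m : M) : Prop :=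
  ∃ (r : ℕ) (a : Fin r → R) (x : Fin r → M) (k : ℕ),
    0 < r ∧ 0 < k ∧ m = ∑ i, a i • x i ∧ ∀ i, (a i) ^ k • x i = 0

/-- A reduced module: `a ^ k • m = 0` (for some positive `k`) implies `a • m = 0`,
i.e. `E_M(0) = 0`. -/
def IsReducedModule (R : Type u) [CommRing R] (M : Type v) [AddCommGroup M] [Module R M] : Prop :=
  ∀ (a : R) (m : M) (k : ℕ), 0 < k → a ^ k • m = 0 → a • m = 0

/-- A nonempty family of submodules of a Noetherian uniserial module has a greatest member. -/
theorem exists_forall_le_of_uniserial {R : Type u} [CommRing R] {M : Type v} [AddCommGroup M]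
    [Module R M] [IsNoetherian R M] (hu : ∀ N K : Submodule R M, N ≤ K ∨ K ≤ N)
    {ι : Type*} [Nonempty ι] (f : ι → Submodule R M) : ∃ i, ∀ j, f j ≤ f i := by
  obtain ⟨_, ⟨i, rfl⟩, hi⟩ := (wellFounded_gt (α := Submodule R M)).has_min
    (Set.range f) (Set.range_nonempty f)
  exact ⟨i, fun j => (hu (f j) (f i)).elim id fun h =>
    (h.eq_or_lt.resolve_right (hi _ ⟨j, rfl⟩)).ge⟩

/-- A Noetherian uniserial module is cyclic. -/
theorem exists_generator_of_uniserial {R : Type u} [CommRing R] {M : Type v} [AddCommGroup M]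
    [Module R M] [IsNoetherian R M] (hu : ∀ N K : Submodule R M, N ≤ K ∨ K ≤ N) :
    ∃ g : M, ∀ m : M, ∃ r : R, r • g = m := by
  obtain ⟨g, hg⟩ := exists_forall_le_of_uniserial hu fun m : M => R ∙ m
  exact ⟨g, fun m => mem_span_singleton.1 (hg m (mem_span_singleton_self m))⟩

theorem mem_aGamma_iff {R : Type u} [CommRing R] {M : Type v} [AddCommGroup M] [Module R M]
    {a : R} {x : M} :
    x ∈ aGamma (M := M) a ↔ ∃ m : M, (∃ k : ℕ, 0 < k ∧ a ^ k • m = 0) ∧ a • m = x :=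
  Iff.rfl

theorem IsSemiprimeSub.smul_mem_of_pow_smul_mem {R : Type u} [CommRing R] {M : Type v}
    [AddCommGroup M] [Module R M] {K : Submodule R M} (hK : IsSemiprimeSub K) {a : R} {m : M}
    {k : ℕ} (h : a ^ k • m ∈ K) : a • m ∈ K := by
  induction k with
  | zero => exact K.smul_mem a (by simpa using h)
  | succ k ih =>
    cases k with
    | zero => simpa using h
    | succ k =>
      refine ih ?_
      have h2 : a ^ 2 • a ^ k • m ∈ K := by
        rwa [smul_smul, ← pow_add, add_comm 2 k]
      simpa [smul_smul, pow_succ'] using hK.2 a _ h2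

theorem envSet_bot_subset_spRadical {R : Type u} [CommRing R] {M : Type v} [AddCommGroup M]
    [Module R M] : envSet (⊥ : Submodule R M) ⊆ spRadical (⊥ : Submodule R M) := by
  rintro _ ⟨a, m, k, -, h, rfl⟩
  exact Submodule.mem_sInf.2 fun K hK => hK.1.smul_mem_of_pow_smul_mem (hK.2 h)

/-- The envelope of zero in a cyclic module consists of the multiples `r • g` of the generator
with `r` nilpotent on `g`. -/
theorem smul_mem_envSet_bot_iff {R : Type u} [CommRing R] {M : Type v} [AddCommGroup M]
    [Module R M] {g : M} (hg : ∀ m : M, ∃ r : R, r • g = m) {r : R} :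
    r • g ∈ envSet (⊥ : Submodule R M) ↔ ∃ k : ℕ, r ^ k • g = 0 := by
  constructor
  · rintro ⟨a, m, k, hk, h, hr⟩
    obtain ⟨s, rfl⟩ := hg m
    have hpow : ∀ n : ℕ, r ^ n • g = (a * s) ^ n • g := by
      intro n
      induction n with
      | zero => simp
      | succ n ih =>
        rw [pow_succ, mul_smul, hr, smul_smul a s, smul_comm, ih, smul_smul, ← pow_succ']
    obtain ⟨n, rfl⟩ := Nat.exists_eq_succ_of_ne_zero hk.ne'
    refine ⟨n + 1, ?_⟩
    have h0 : a ^ (n + 1) • s • g = 0 := h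
    rw [hpow, show (a * s) ^ (n + 1) = s ^ n * (a ^ (n + 1) * s) by ring, mul_smul, mul_smul, h0,
      smul_zero]
  · rintro ⟨k, hk⟩
    refine ⟨r, g, k + 1, k.succ_pos, ?_, rfl⟩
    rw [pow_succ', mul_smul, hk, smul_zero]
    exact zero_mem _

/-- For a Noetherian uniserial `R`-module `M`, there exists `a ∈ R` with
`E_M(0) = aΓ_a(M) = S(M)`. -/
theorem stmt17 {R : Type u} [CommRing R] {M : Type v} [AddCommGroup M] [Module R M]
    [IsNoetherian R M] (hu : ∀ N K : Submodule R M, N ≤ K ∨ K ≤ N) :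
    ∃ a : R, envSet (⊥ : Submodule R M) = (aGamma (M := M) a : Set M) ∧
      aGamma (M := M) a = spRadical (⊥ : Submodule R M) := by
  obtain ⟨g, hg⟩ := exists_generator_of_uniserial hu
  obtain ⟨a, ha⟩ := exists_forall_le_of_uniserial hu fun a : R => aGamma (M := M) a
  have henv : envSet (⊥ : Submodule R M) = (aGamma (M := M) a : Set M) := by
    ext x
    constructor
    · rintro ⟨b, m, k, hk, h, rfl⟩
      exact ha b (mem_aGamma_iff.2 ⟨m, ⟨k, hk, h⟩, rfl⟩)
    · intro hx
      obtain ⟨m, ⟨k, hk, h⟩, rfl⟩ := mem_aGamma_iff.1 hx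
      exact ⟨a, m, k, hk, h, rfl⟩
  have hle : aGamma (M := M) a ≤ spRadical (⊥ : Submodule R M) := fun x hx =>
    envSet_bot_subset_spRadical (henv.symm ▸ hx : x ∈ envSet (⊥ : Submodule R M))
  have hmem : ∀ r : R, r • g ∈ aGamma (M := M) a ↔ ∃ k : ℕ, r ^ k • g = 0 := fun r => by
    rw [← smul_mem_envSet_bot_iff hg, henv, SetLike.mem_coe]
  refine ⟨a, henv, le_antisymm hle ?_⟩
  by_cases htop : aGamma (M := M) a = ⊤
  · exact htop ▸ le_top
  · refine sInf_le ⟨⟨htop, fun b m hb => ?_⟩, bot_le⟩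
    obtain ⟨s, rfl⟩ := hg m
    rw [smul_smul] at hb ⊢
    obtain ⟨k, hk⟩ := (hmem _).1 hb
    refine (hmem _).2 ⟨2 * k, ?_⟩
    rw [show (b * s) ^ (2 * k) = s ^ k * (b ^ 2 * s) ^ k by ring, mul_smul, hk, smul_zero]
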